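/- Let A be a complex unital Banach algebra, let M be a left A-module (no topology assumed on M), and let S be a non-empty subset of M satisfying: (1) S generates M as an A-module, i.e., every element of M is a finite sum of elements aᵢsᵢ with aᵢ ∈ A and sᵢ ∈ S; (2) if a ∈ A is invertible and s ∈ S, then a·s ∈ S; (3) for all s₁, s₂ ∈ S there exist a₁, a₂ ∈ A with a₁·S ⊆ S, a₂·S ⊆ S, and a₁·s₁ = a₂·s₂. If Λ : M → ℂ is a linear functional with Λ(s) ≠ 0 for all s ∈ S, then there exists a unique character χ on A (a unital ℂ-algebra homomorphism χ : A → ℂ) such that Λ(a·m) = χ(a)·Λ(m) for all a ∈ A and m ∈ M. -/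

import Mathlib

/-- Newton's identity in degree two for multisets. -/
theorem Multiset.esymm_one_sq {R : Type*} [CommRing R] (s : Multiset R) :
    s.esymm 1 ^ 2 = (s.map (· ^ 2)).sum + 2 * s.esymm 2 := by
  have hone (t : Multiset R) : t.esymm 1 = t.sum := by
    simp [Multiset.esymm, Multiset.powersetCard_one]
  rw [hone]
  induction s using Multiset.induction_on with
  | empty => simp [Multiset.esymm, Multiset.powersetCard_zero_right]
  | cons a s ih =>
    have htwo : (a ::ₘ s).esymm 2 = s.esymm 2 + a * s.sum := by
      rw [← hone s]
      simp [Multiset.esymm, Multiset.powersetCard_cons, Multiset.sum_map_mul_left]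
    rw [htwo, Multiset.sum_cons, Multiset.map_cons, Multiset.sum_cons]
    linear_combination ih

open Polynomial in
/-- A linear functional equal to `1` at the unit and non-vanishing on the units of a complex
Banach algebra preserves squares. -/
theorem LinearMap.map_sq_of_ne_zero_on_units {A : Type*} [NormedRing A] [NormedAlgebra ℂ A]
    [CompleteSpace A] (φ : A →ₗ[ℂ] ℂ) (hφ1 : φ 1 = 1) (hφ : ∀ u : Aˣ, φ u ≠ 0) (b : A) :
    φ (b ^ 2) = φ b ^ 2 := by
  set r : ℝ := ‖b‖ * ‖(1 : A)‖ with hr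
  have key (m : ℕ) :
      ((m : ℝ) + 2) * ‖φ (b ^ 2) - φ b ^ 2‖ ≤ r ^ 2 + ‖φ (b ^ 2)‖ := by
    -- the polynomial `z ↦ φ ((z + b) ^ n)`, whose roots lie in the spectrum of `-b`
    set n := m + 2 with hn
    set P : ℂ[X] := ∑ k ∈ Finset.range (n + 1),
      C ((n.choose k : ℂ) * φ (b ^ (n - k))) * X ^ k with hP
    have hcoeff (k : ℕ) (hk : k ≤ n) :
        P.coeff k = (n.choose k : ℂ) * φ (b ^ (n - k)) := by
      simp only [hP, finsetSum_coeff, coeff_C_mul_X_pow]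
      rw [Finset.sum_ite_eq, if_pos (Finset.mem_range.2 (by omega))]
    have hlead : P.coeff n = 1 := by simp [hcoeff n le_rfl, hφ1]
    have hdeg : P.natDegree = n := by
      refine natDegree_eq_of_le_of_coeff_ne_zero ?_ (by simp [hlead])
      refine natDegree_sum_le_of_forall_le _ _ fun k hk => ?_
      exact (natDegree_C_mul_X_pow_le _ _).trans (by
        have := Finset.mem_range.1 hk
        omega)
    have hmonic : P.leadingCoeff = 1 := by rw [leadingCoeff, hdeg, hlead]
    have heval (z : ℂ) : P.eval z = φ ((algebraMap ℂ A z + b) ^ n) := by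
      rw [(Algebra.commute_algebraMap_left z b).add_pow, map_sum, hP,
        eval_finsetSum]
      refine Finset.sum_congr rfl fun k _ => ?_
      have : algebraMap ℂ A z ^ k * b ^ (n - k) * (n.choose k : A)
          = (z ^ k * (n.choose k : ℂ)) • b ^ (n - k) := by
        rw [← map_pow, ← map_natCast (algebraMap ℂ A), ← Algebra.commutes, ← mul_assoc,
          ← map_mul, Algebra.smul_def, mul_comm (z ^ k)]
      rw [this, map_smul]
      simp only [eval_mul, eval_C, eval_pow, eval_X, smul_eq_mul]
      ring
    have hroot : ∀ z ∈ P.roots, ‖z‖ ≤ r := by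
      intro z hz
      have h0 : φ ((algebraMap ℂ A z + b) ^ n) = 0 := by
        rw [← heval]
        exact (mem_roots'.1 hz).2
      have hmem : z ∈ spectrum ℂ (-b) := by
        rw [spectrum.mem_iff, sub_neg_eq_add]
        intro hu
        exact hφ (hu.pow n).unit h0
      simpa [hr] using spectrum.norm_le_norm_mul_of_mem hmem
    have hcard : P.roots.card = P.natDegree := IsAlgClosed.card_roots_eq_natDegree
    have hcardn : P.roots.card = n := hcard.trans hdeg
    have e1 : P.roots.esymm 1 = -((n : ℂ) * φ b) := by
      have h := coeff_eq_esymm_roots_of_card hcard (k := n - 1) (by omega)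
      rw [hcoeff _ (by omega), hdeg, hmonic, show n - (n - 1) = 1 by omega,
        Nat.choose_symm (by omega : 1 ≤ n), Nat.choose_one_right, pow_one] at h
      linear_combination h
    have e2 : P.roots.esymm 2 = (n.choose 2 : ℂ) * φ (b ^ 2) := by
      have h := coeff_eq_esymm_roots_of_card hcard (k := n - 2) (by omega)
      rw [hcoeff _ (by omega), hdeg, hmonic, show n - (n - 2) = 2 by omega,
        Nat.choose_symm (by omega : 2 ≤ n)] at h
      linear_combination -h
    have newton := P.roots.esymm_one_sq
    rw [e1, e2, Nat.cast_choose_two] at newton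
    have hsum : ‖(P.roots.map (· ^ 2)).sum‖ ≤ n * r ^ 2 := by
      refine (norm_multiset_sum_le _).trans ?_
      rw [← hcardn, ← nsmul_eq_mul, ← P.roots.card_map (fun z => ‖z ^ 2‖), Multiset.map_map]
      refine Multiset.sum_le_card_nsmul _ _ fun x hx => ?_
      obtain ⟨z, hz, rfl⟩ := Multiset.mem_map.1 hx
      simpa using pow_le_pow_left₀ (norm_nonneg z) (hroot z hz) 2
    have hid : (n : ℂ) ^ 2 * (φ (b ^ 2) - φ b ^ 2)
        = n * φ (b ^ 2) - (P.roots.map (· ^ 2)).sum := by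
      linear_combination -newton
    have hnorm := congrArg norm hid
    rw [norm_mul, norm_pow, Complex.norm_natCast] at hnorm
    have htri := norm_sub_le ((n : ℂ) * φ (b ^ 2)) (P.roots.map (· ^ 2)).sum
    rw [norm_mul, Complex.norm_natCast, ← hnorm] at htri
    have hnpos : (0 : ℝ) < n := by positivity
    have hncast : (n : ℝ) = m + 2 := by simp [hn]
    rw [← hncast]
    refine le_of_mul_le_mul_left ?_ hnpos
    linarith
  by_contra hne
  have hpos : 0 < ‖φ (b ^ 2) - φ b ^ 2‖ := norm_pos_iff.2 (sub_ne_zero.2 hne)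
  obtain ⟨m, hm⟩ := exists_nat_gt ((r ^ 2 + ‖φ (b ^ 2)‖) / ‖φ (b ^ 2) - φ b ^ 2‖)
  rw [div_lt_iff₀ hpos] at hm
  linarith [key m]

/-- A unital linear functional preserving squares is multiplicative. -/
theorem LinearMap.map_mul_of_map_sq {A : Type*} [Ring A] [Algebra ℂ A]
    (φ : A →ₗ[ℂ] ℂ) (hφ1 : φ 1 = 1) (hsq : ∀ a, φ (a ^ 2) = φ a ^ 2) (x y : A) :
    φ (x * y) = φ x * φ y := by
  have jordan (a b : A) : φ (a * b + b * a) = 2 * φ a * φ b := by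
    have h := hsq (a + b)
    rw [show (a + b) ^ 2 = a ^ 2 + (a * b + b * a) + b ^ 2 by noncomm_ring] at h
    simp only [map_add, hsq] at h ⊢
    linear_combination h
  have ker (a b : A) (ha : φ a = 0) : φ (a * b) = 0 := by
    have hadd := jordan a b
    have hsub := hsq (a * b - b * a)
    have h : (a * b - b * a) ^ 2 = (2 : ℂ) • (a * (b * a * b) + b * a * b * a)
        - (a * b + b * a) ^ 2 := by
      rw [two_smul]
      noncomm_ring
    rw [h, map_sub, map_smul, jordan, hsq, hadd, ha] at hsub
    have hcomm : φ (a * b - b * a) = 0 := by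
      simpa using hsub.symm
    rw [map_sub] at hcomm
    rw [map_add, ha] at hadd
    linear_combination (hcomm + hadd) / 2
  have h := ker (x - φ x • 1) y (by simp [hφ1])
  rw [sub_mul, smul_mul_assoc, one_mul, map_sub, map_smul, smul_eq_mul] at h
  exact sub_eq_zero.1 h

/-- The **Gleason–Kahane–Żelazko theorem**: a linear functional on a complex Banach algebra,
equal to `1` at the unit and non-vanishing on units, is a character. -/
def LinearMap.toAlgHomOfNeZeroOnUnits {A : Type*} [NormedRing A] [NormedAlgebra ℂ A]
    [CompleteSpace A] (φ : A →ₗ[ℂ] ℂ) (hφ1 : φ 1 = 1) (hφ : ∀ u : Aˣ, φ u ≠ 0) :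
    A →ₐ[ℂ] ℂ :=
  AlgHom.ofLinearMap φ hφ1 (φ.map_mul_of_map_sq hφ1 (φ.map_sq_of_ne_zero_on_units hφ1 hφ))


/-- Abstract Gleason–Kahane–Żelazko theorem for modules: if `A` is a complex
unital Banach algebra, `M` a left `A`-module (also a ℂ-vector space compatibly
with the `A`-action), `S ⊆ M` a non-empty subset that generates `M` over `A`,
is stable under multiplication by invertible elements of `A`, and satisfies the
common-multiple condition (3), then every ℂ-linear functional `Λ : M → ℂ` that
is non-zero on `S` satisfies `Λ(a•m) = χ(a)·Λ(m)` for a unique character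
`χ : A → ℂ`. -/
theorem module_GKZ {A : Type*} [NormedRing A] [NormedAlgebra ℂ A] [CompleteSpace A]
    {M : Type*} [AddCommGroup M] [Module A M] [Module ℂ M] [IsScalarTower ℂ A M]
    (S : Set M) (hS : S.Nonempty)
    (h1 : Submodule.span A S = ⊤)
    (h2 : ∀ (a : Aˣ), ∀ s ∈ S, (a : A) • s ∈ S)
    (h3 : ∀ s₁ ∈ S, ∀ s₂ ∈ S, ∃ a₁ a₂ : A,
      (∀ s ∈ S, a₁ • s ∈ S) ∧ (∀ s ∈ S, a₂ • s ∈ S) ∧ a₁ • s₁ = a₂ • s₂)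
    (Λ : M →ₗ[ℂ] ℂ) (hΛ : ∀ s ∈ S, Λ s ≠ 0) :
    ∃! χ : A →ₐ[ℂ] ℂ, ∀ (a : A) (m : M), Λ (a • m) = χ a * Λ m := by
  have hchar : ∀ s ∈ S, ∃ χ : A →ₐ[ℂ] ℂ, ∀ a : A, Λ (a • s) = χ a * Λ s := by
    intro s hs
    let φ : A →ₗ[ℂ] ℂ :=
      { toFun := fun a => Λ (a • s) / Λ s
        map_add' := fun a b => by rw [add_smul, map_add, add_div]
        map_smul' := fun c a => by
          rw [smul_assoc, map_smul, smul_eq_mul, mul_div_assoc, RingHom.id_apply, smul_eq_mul] }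
    have hφ1 : φ 1 = 1 := by simp [φ, hΛ s hs]
    have hφ (u : Aˣ) : φ u ≠ 0 := div_ne_zero (hΛ _ (h2 u s hs)) (hΛ s hs)
    exact ⟨φ.toAlgHomOfNeZeroOnUnits hφ1 hφ, fun a => (div_mul_cancel₀ _ (hΛ s hs)).symm⟩
  have hsmul {s : M} {χ : A →ₐ[ℂ] ℂ} (hχ : ∀ a : A, Λ (a • s) = χ a * Λ s) (a c : A) :
      Λ (a • c • s) = χ a * Λ (c • s) := by
    rw [← mul_smul, hχ, hχ, map_mul, mul_assoc]
  obtain ⟨s₀, hs₀⟩ := hS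
  obtain ⟨χ, hχ⟩ := hchar s₀ hs₀
  have hχS : ∀ s ∈ S, ∀ a : A, Λ (a • s) = χ a * Λ s := by
    intro s hs a
    obtain ⟨ψ, hψ⟩ := hchar s hs
    obtain ⟨a₁, a₂, ha₁, -, h⟩ := h3 s₀ hs₀ s hs
    have heq : χ a = ψ a := by
      refine mul_right_cancel₀ (hΛ _ (ha₁ s₀ hs₀)) ?_
      rw [← hsmul hχ, h, hsmul hψ]
    rw [hψ, heq]
  refine ⟨χ, fun a m => ?_, fun ψ hψ => ?_⟩
  · have hm : m ∈ Submodule.span A S := h1 ▸ Submodule.mem_top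
    induction hm using Submodule.span_induction generalizing a with
    | mem s hs => exact hχS s hs a
    | zero => simp
    | add x y _ _ hx hy => rw [smul_add, map_add, map_add, hx, hy, mul_add]
    | smul c x _ hx => rw [← mul_smul, hx, hx, map_mul, mul_assoc]
  · ext a
    exact mul_right_cancel₀ (hΛ s₀ hs₀) ((hψ a s₀).symm.trans (hχ a))
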